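/- arXiv:2207.10375 — 2 statements merged into one kernel-verified Lean document; each statement's English description precedes it below -/
import Mathlib

section
/- Let p be a prime with p ≡ 1 (mod 4), ψ a nontrivial additive character of F_p with values in ℂ, φ the quadratic character of F_p, and let A be any multiplicative character of F_p^× of order 4 (so that A² = φ). Then ∑_{x∈F_p} φ(x(x-1)(x+1)) = A(-1) · (g(φA)·g(A⁻¹) + g(φA⁻¹)·g(A)) / g(φ); equivalently, a_p(-1) = -A(-1)·(g(φA)g(A⁻¹) + g(φA⁻¹)g(A))/g(φ). -/
open Finset

namespace MulChar

/-- A finite field has at most one character of order two with values in a given domain. -/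
theorem eq_of_sq_eq_one {F R : Type*} [Field F] [Finite F] [CommRing R] [IsDomain R]
    {χ η : MulChar F R} (hχ : χ ≠ 1) (hχ2 : χ ^ 2 = 1) (hη : η ≠ 1) (hη2 : η ^ 2 = 1) :
    χ = η := by
  obtain ⟨g, hg⟩ := IsCyclic.exists_generator (α := Fˣ)
  have key : ∀ θ : MulChar F R, θ ≠ 1 → θ ^ 2 = 1 → θ g = -1 := by
    intro θ hθ hθ2
    have h1 : θ g ^ 2 = 1 := by
      rw [← pow_apply_coe, hθ2, one_apply_coe]
    refine (eq_or_eq_neg_of_sq_eq_sq _ _ (h1.trans (one_pow 2).symm)).resolve_left ?_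
    rwa [← one_apply_coe (R' := R) g, ← eq_iff hg]
  rw [eq_iff hg, key χ hχ hχ2, key η hη hη2]

end MulChar

/-- Summing a function of `x ^ 2` over a finite field of odd characteristic. -/
theorem sum_comp_sq_eq_sum_one_add_quadraticChar {F R : Type*} [Field F] [Fintype F]
    [DecidableEq F] [CommRing R] (hF : ringChar F ≠ 2) (f : F → R) :
    ∑ x : F, f (x ^ 2) = ∑ y : F, (1 + (quadraticChar F y : R)) * f y := by
  rw [← Finset.sum_fiberwise (g := fun x : F => x ^ 2)]
  refine Finset.sum_congr rfl fun y _ => ?_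
  have hcard := quadraticChar_card_sqrts hF y
  rw [Finset.sum_congr rfl (g := fun _ => f y)
    (fun x hx => by rw [(Finset.mem_filter.mp hx).2]), Finset.sum_const, nsmul_eq_mul]
  congr 1
  have hset : {x : F | x ^ 2 = y}.toFinset = Finset.univ.filter fun x => x ^ 2 = y := by
    ext x; simp
  rw [hset] at hcard
  rw [← Int.cast_natCast, hcard]
  push_cast
  ring

/-- If `A` has order four, then `J(A, A ^ 2) = A(-1) g(A) ^ 2 / g(A ^ 2)`. -/
theorem jacobiSum_sq_eq_gaussSum {F K : Type*} [Field F] [Fintype F] [Field K]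
    (hF : (Fintype.card F : K) ≠ 0) {A : MulChar F K} (hA : orderOf A = 4)
    {ψ : AddChar F K} (hψ : ψ.IsPrimitive) :
    jacobiSum A (A ^ 2) = A (-1) * gaussSum A ψ ^ 2 / gaussSum (A ^ 2) ψ := by
  have hA4 : A ^ 4 = 1 := hA ▸ pow_orderOf_eq_one A
  have hne : ∀ n, n ≠ 0 → n < 4 → A ^ n ≠ 1 := fun n h0 h =>
    pow_ne_one_of_lt_orderOf h0 (hA ▸ h)
  have hA1 : A ≠ 1 := by simpa using hne 1 (by norm_num) (by norm_num)
  have hA2 : A ^ 2 ≠ 1 := hne 2 (by norm_num) (by norm_num)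
  have hA3 : A * A ^ 2 ≠ 1 := by
    rw [← pow_succ']
    exact hne 3 (by norm_num) (by norm_num)
  have hinv : A * A ^ 2 = A⁻¹ := by
    rw [eq_inv_iff_mul_eq_one, ← pow_succ', ← pow_succ, hA4]
  have hsqinv : (A ^ 2)⁻¹ = A ^ 2 := by
    rw [inv_eq_iff_mul_eq_one, ← pow_add, hA4]
  have hJ := jacobiSum_mul_nontrivial hA3 ψ
  have hAsq : A (-1) ^ 2 = 1 := by
    rw [← map_pow, neg_one_sq, map_one]
  have hg1 : gaussSum A ψ * gaussSum A⁻¹ ψ = A (-1) * Fintype.card F := by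
    have h := gaussSum_mul_gaussSum_pow_orderOf_sub_one hA1 hψ
    rwa [hA, pow_succ', hinv] at h
  have hg2 : gaussSum (A ^ 2) ψ ^ 2 = Fintype.card F := by
    have h := gaussSum_mul_gaussSum_eq_card hA2 hψ
    have h' := mul_gaussSum_inv_eq_gaussSum (A ^ 2) ψ
    rw [MulChar.pow_apply' _ two_ne_zero, hAsq, one_mul] at h'
    rwa [hsqinv, h', ← pow_two] at h
  have hgA : gaussSum A⁻¹ ψ ≠ 0 :=
    gaussSum_ne_zero_of_nontrivial hF (inv_ne_one.mpr hA1) hψ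
  have hgA2 : gaussSum (A ^ 2) ψ ≠ 0 := gaussSum_ne_zero_of_nontrivial hF hA2 hψ
  rw [hinv] at hJ
  rw [eq_div_iff hgA2]
  refine mul_left_cancel₀ hgA ?_
  linear_combination gaussSum (A ^ 2) ψ * hJ + gaussSum A ψ * hg2
    - A (-1) * gaussSum A ψ * hg1 - gaussSum A ψ * Fintype.card F * hAsq

/-- For a prime `p ≡ 1 (mod 4)`, a nontrivial additive character `ψ` of `F_p` with
values in `ℂ`, the quadratic character `φ` of `F_p` (viewed with values in `ℂ`), and
any multiplicative character `A` of `F_p` of order `4` (so that `A² = φ`), one has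
`∑_{x ∈ F_p} φ(x(x-1)(x+1)) = A(-1)·(g(φA)·g(A⁻¹) + g(φA⁻¹)·g(A))/g(φ)`;
equivalently, `a_p(-1) = -A(-1)·(g(φA)g(A⁻¹) + g(φA⁻¹)g(A))/g(φ)`. -/
theorem ap_neg_one_eq_gaussSum_of_one_mod_four (p : ℕ) [Fact p.Prime] (hp : p % 4 = 1)
    (ψ : AddChar (ZMod p) ℂ) (hψ : ψ ≠ 1)
    (A : MulChar (ZMod p) ℂ) (hA : orderOf A = 4) :
    let φ : MulChar (ZMod p) ℂ := (quadraticChar (ZMod p)).ringHomComp (Int.castRingHom ℂ)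
    ((∑ x : ZMod p, quadraticChar (ZMod p) (x * (x - 1) * (x + 1)) : ℤ) : ℂ) =
      A (-1) * (gaussSum (φ * A) ψ * gaussSum A⁻¹ ψ +
        gaussSum (φ * A⁻¹) ψ * gaussSum A ψ) / gaussSum φ ψ := by
  intro φ
  have hp2 : p ≠ 2 := by omega
  have hchar : ringChar (ZMod p) ≠ 2 := by rwa [ZMod.ringChar_zmod_n]
  have hcard : (Fintype.card (ZMod p) : ℂ) ≠ 0 := by
    simpa using (Fact.out : p.Prime).ne_zero
  have hprim : ψ.IsPrimitive := AddChar.IsPrimitive.of_ne_one hψ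
  have hA4 : A ^ 4 = 1 := hA ▸ pow_orderOf_eq_one A
  have hA2 : A ^ 2 ≠ 1 := pow_ne_one_of_lt_orderOf two_ne_zero (by omega)
  have hφ : φ = A ^ 2 := by
    refine MulChar.eq_of_sq_eq_one ?_ ?_ hA2 (by rw [← pow_mul, hA4])
    · exact (MulChar.ringHomComp_ne_one_iff Int.cast_injective).mpr (quadraticChar_ne_one hchar)
    · exact ((quadraticChar_isQuadratic (ZMod p)).comp (Int.castRingHom ℂ)).sq_eq_one
  have hinv : A ^ 2 * A = A⁻¹ := by
    rw [eq_inv_iff_mul_eq_one, ← pow_succ, ← pow_succ, hA4]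
  have hinv' : A ^ 2 * A⁻¹ = A := by
    rw [pow_two, mul_inv_cancel_right]
  have hinvsq : A⁻¹ ^ 2 = A ^ 2 := by
    rw [inv_pow, inv_eq_iff_mul_eq_one, ← pow_add, hA4]
  have hAsq : A (-1) ^ 2 = 1 := by
    rw [← map_pow, neg_one_sq, map_one]
  have happ : ∀ x, (quadraticChar (ZMod p) x : ℂ) = A x ^ 2 := fun x => by
    rw [← MulChar.pow_apply' A two_ne_zero, ← hφ]
    rfl
  have hsum : ((∑ x : ZMod p, quadraticChar (ZMod p) (x * (x - 1) * (x + 1)) : ℤ) : ℂ) =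
      jacobiSum A (A ^ 2) + jacobiSum A⁻¹ (A⁻¹ ^ 2) := by
    calc _ = ∑ x : ZMod p, A (x ^ 2) * A (1 - x ^ 2) ^ 2 := by
          push_cast
          refine Finset.sum_congr rfl fun x _ => ?_
          rw [happ, show x * (x - 1) * (x + 1) = -1 * (x * (1 - x ^ 2)) by ring]
          simp only [map_mul, map_pow, mul_pow, hAsq, one_mul]
      _ = ∑ y : ZMod p, (1 + (quadraticChar (ZMod p) y : ℂ)) * (A y * A (1 - y) ^ 2) :=
          sum_comp_sq_eq_sum_one_add_quadraticChar hchar fun y => A y * A (1 - y) ^ 2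
      _ = _ := by
          rw [hinvsq, ← hinv, jacobiSum, jacobiSum, ← Finset.sum_add_distrib]
          refine Finset.sum_congr rfl fun y _ => ?_
          rw [happ, MulChar.mul_apply, MulChar.pow_apply' _ two_ne_zero,
            MulChar.pow_apply' _ two_ne_zero]
          ring
  have hAinv : A⁻¹ (-1) = A (-1) := by
    rw [MulChar.inv_apply', inv_neg_one]
  rw [hsum, jacobiSum_sq_eq_gaussSum hcard hA hprim,
    jacobiSum_sq_eq_gaussSum hcard ((orderOf_inv A).trans hA) hprim, hφ, hinv, hinv', hinvsq,
    hAinv]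
  ring
end

section
/- Let p be an odd prime and φ the quadratic character of F_p. Then |∑_{x∈F_p} φ(x³ - x)| ≤ 2√p; equivalently, |a_p(-1)| ≤ 2√p for the curve y² = x(x-1)(x+1). -/
open Finset

section HasseBound

variable {F : Type*} [Field F] [Fintype F] [DecidableEq F]

theorem sum_quadraticChar_sub_mul_sub (hF : ringChar F ≠ 2) (u v : F) :
    ∑ a, quadraticChar F (u - a) * quadraticChar F (v - a) =
      (if u = v then (Fintype.card F : ℤ) else 0) - 1 := by
  split_ifs with h
  · subst h
    rw [← (Equiv.subLeft u).sum_comp]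
    simp only [Equiv.subLeft_apply, sub_sub_cancel, ← sq]
    rw [← Finset.add_sum_erase _ _ (mem_univ (0 : F)),
      Finset.sum_congr rfl fun x hx ↦ quadraticChar_sq_one (ne_of_mem_erase hx)]
    simp [card_erase_of_mem, Nat.cast_sub Fintype.card_pos]
  · have hc : v - u ≠ 0 := sub_ne_zero.mpr (Ne.symm h)
    have key := jacobiSum_nontrivial_inv (quadraticChar_ne_one hF)
    rw [(quadraticChar_isQuadratic F).inv, jacobiSum] at key
    rw [← ((Equiv.mulLeft₀ _ hc).trans (Equiv.addLeft u)).sum_comp]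
    have hterm (t : F) : quadraticChar F (u - (u + (v - u) * t)) *
        quadraticChar F (v - (u + (v - u) * t)) =
        quadraticChar F (-1) * (quadraticChar F t * quadraticChar F (1 - t)) := by
      have h1 : (u - (u + (v - u) * t)) * (v - (u + (v - u) * t)) =
          -1 * (t * (1 - t)) * (v - u) ^ 2 := by ring
      rw [← map_mul, h1, map_mul, quadraticChar_sq_one' hc, mul_one, map_mul, map_mul]
    simp only [Equiv.trans_apply, Equiv.mulLeft₀_apply, Equiv.coe_addLeft, hterm, ← mul_sum, key]
    have := quadraticChar_sq_one (F := F) (neg_ne_zero.mpr one_ne_zero)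
    linarith

theorem card_filter_sq_eq_le_two (hF : ringChar F ≠ 2) (a : F) :
    (#{x : F | x ^ 2 = a} : ℤ) ≤ 2 := by
  have h := quadraticChar_card_sqrts hF a
  rw [Set.toFinset_ofPred] at h
  rw [h]
  rcases quadraticChar_isQuadratic F a with h | h | h <;> rw [h] <;> norm_num

theorem quadraticChar_sum_cubic_mul_sq {k : F} (hk : k ≠ 0) :
    (∑ x, quadraticChar F (x ^ 3 - k ^ 2 * x)) ^ 2 =
      (∑ x, quadraticChar F (x ^ 3 - x)) ^ 2 := by
  rw [← Equiv.sum_comp (Equiv.mulLeft₀ k hk)]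
  have hterm (x : F) : quadraticChar F ((k * x) ^ 3 - k ^ 2 * (k * x)) =
      quadraticChar F k * quadraticChar F (x ^ 3 - x) := by
    rw [show (k * x) ^ 3 - k ^ 2 * (k * x) = k * (x ^ 3 - x) * k ^ 2 by ring, map_mul,
      quadraticChar_sq_one' hk, mul_one, map_mul]
  simp only [Equiv.mulLeft₀_apply, hterm]
  rw [← mul_sum, mul_pow, quadraticChar_sq_one hk, one_mul]

/-- Second moment over the family of curves `y² = x³ - a x`. -/
theorem sum_sq_quadraticChar_sum_cubic_le (hF : ringChar F ≠ 2) :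
    ∑ a : F, (∑ x, quadraticChar F (x ^ 3 - a * x)) ^ 2 ≤
      2 * Fintype.card F * (Fintype.card F - 1 : ℤ) := by
  have hexpand : ∑ a : F, (∑ x, quadraticChar F (x ^ 3 - a * x)) ^ 2 =
      ∑ x : F, ∑ y : F, quadraticChar F x * quadraticChar F y *
        ((if x ^ 2 = y ^ 2 then (Fintype.card F : ℤ) else 0) - 1) := by
    simp only [← sum_quadraticChar_sub_mul_sub hF, sq (∑ x, _), sum_mul_sum]
    rw [sum_comm]
    refine sum_congr rfl fun x _ ↦ ?_
    rw [sum_comm]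
    simp only [mul_sum]
    refine sum_congr rfl fun y _ ↦ sum_congr rfl fun a _ ↦ ?_
    simp only [← map_mul]
    ring_nf
  have hdiag (x : F) : ∑ y : F, quadraticChar F x * quadraticChar F y *
      (if x ^ 2 = y ^ 2 then (Fintype.card F : ℤ) else 0) ≤
      if x = 0 then 0 else 2 * (Fintype.card F : ℤ) := by
    split_ifs with hx
    · simp [hx]
    · calc _ ≤ ∑ y : F, if y ^ 2 = x ^ 2 then (Fintype.card F : ℤ) else 0 := by
            refine sum_le_sum fun y _ ↦ ?_
            simp only [← map_mul, eq_comm (a := x ^ 2)]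
            split_ifs
            · rcases quadraticChar_isQuadratic F (x * y) with h | h | h <;> rw [h] <;> simp
            · simp
        _ = #{y : F | y ^ 2 = x ^ 2} * (Fintype.card F : ℤ) := by
            rw [← sum_filter, sum_const, nsmul_eq_mul]
        _ ≤ _ := by gcongr; exact card_filter_sq_eq_le_two hF _
  rw [hexpand]
  have hoff (x : F) : ∑ y : F, quadraticChar F x * quadraticChar F y = 0 := by
    rw [← mul_sum, quadraticChar_sum_zero hF, mul_zero]
  simp only [mul_sub, mul_one, sum_sub_distrib, hoff, sub_zero]
  refine (sum_le_sum fun x _ ↦ hdiag x).trans_eq ?_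
  rw [← Finset.add_sum_erase _ _ (mem_univ (0 : F)),
    Finset.sum_congr rfl fun x hx ↦ if_neg (ne_of_mem_erase hx)]
  simp [card_erase_of_mem, Nat.cast_sub Fintype.card_pos]
  ring

theorem sq_quadraticChar_sum_cubic_le (hF : ringChar F ≠ 2) :
    (∑ x : F, quadraticChar F (x ^ 3 - x)) ^ 2 ≤ 4 * Fintype.card F := by
  set S : F → ℤ := fun a ↦ (∑ x, quadraticChar F (x ^ 3 - a * x)) ^ 2
  have hS0 (a : F) : 0 ≤ S a := sq_nonneg _
  have hlower : (Fintype.card F - 1 : ℤ) * (∑ x : F, quadraticChar F (x ^ 3 - x)) ^ 2 ≤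
      ∑ k : F, S (k ^ 2) := by
    rw [← Finset.add_sum_erase _ (fun k ↦ S (k ^ 2)) (mem_univ 0), Finset.sum_congr rfl fun k hk ↦
      quadraticChar_sum_cubic_mul_sq (ne_of_mem_erase hk), sum_const, nsmul_eq_mul,
      card_erase_of_mem (mem_univ _), card_univ, Nat.cast_sub Fintype.card_pos]
    simpa using hS0 _
  have hupper : ∑ k : F, S (k ^ 2) ≤ 2 * ∑ a : F, S a := by
    rw [← sum_fiberwise univ (fun k : F ↦ k ^ 2), mul_sum]
    refine sum_le_sum fun a _ ↦ ?_
    rw [sum_congr rfl fun k hk ↦ congrArg S (mem_filter.mp hk).2, sum_const, nsmul_eq_mul]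
    exact mul_le_mul_of_nonneg_right (card_filter_sq_eq_le_two hF a) (hS0 a)
  have hmoment := sum_sq_quadraticChar_sum_cubic_le hF
  have hcard : (0 : ℤ) < Fintype.card F - 1 :=
    sub_pos.mpr (mod_cast Fintype.one_lt_card)
  refine le_of_mul_le_mul_left ?_ hcard
  linarith

end HasseBound

/-- **Hasse bound at `λ = -1`.** For an odd prime `p` and the quadratic character `φ`
of `F_p`, one has `|∑_{x ∈ F_p} φ(x³ - x)| ≤ 2√p`; equivalently, `|a_p(-1)| ≤ 2√p`
for the elliptic curve `y² = x(x-1)(x+1) = x³ - x`. -/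
theorem abs_ap_neg_one_le_two_sqrt (p : ℕ) [Fact p.Prime] (hp : Odd p) :
    |((∑ x : ZMod p, quadraticChar (ZMod p) (x ^ 3 - x) : ℤ) : ℝ)| ≤
      2 * Real.sqrt p := by
  have hF : ringChar (ZMod p) ≠ 2 := by
    rw [ZMod.ringChar_zmod_n]
    rintro rfl
    exact absurd hp (by decide)
  have h := sq_quadraticChar_sum_cubic_le hF
  rw [ZMod.card] at h
  refine abs_le_of_sq_le_sq ?_ (by positivity)
  rw [mul_pow, Real.sq_sqrt (Nat.cast_nonneg p)]
  norm_num
  exact_mod_cast h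
end
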